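/- arXiv:1710.04357 — 7 statements merged into one kernel-verified Lean document; each statement's English description precedes it below -/
import Mathlib

section
/- Let N ≥ 2, let δ > 0, and let Q : Fin N → ℝ be nondecreasing (Q i ≤ Q j whenever i ≤ j). Let Δ : Fin N → ℝ satisfy ∑_{n} Δ n = 0, be tilted (there exists k ∈ ℕ with k ≤ N such that Δ n ≥ 0 for (n : ℕ) < k and Δ n ≤ 0 for (n : ℕ) ≥ k), and in addition satisfy Δ 0 ≥ δ and Δ (N-1) ≤ -δ (i.e., Δ is δ-tilted). Then ∑_{n} Q n * Δ n ≤ -δ * (Q (N-1) - Q 0). -/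
/-- Eq. (8): a δ-tilted distribution is strictly better than random routing. -/
theorem delta_tilted_inner_product_bound
    (N : ℕ) (hN : 2 ≤ N) (δ : ℝ) (hδ : 0 < δ) (Q Δ : Fin N → ℝ)
    (hQmono : ∀ i j : Fin N, i ≤ j → Q i ≤ Q j)
    (hΔsum : ∑ n, Δ n = 0)
    (hΔtilted : ∃ k : ℕ, k ≤ N ∧ (∀ n : Fin N, (n : ℕ) < k → 0 ≤ Δ n) ∧
        (∀ n : Fin N, k ≤ (n : ℕ) → Δ n ≤ 0))
    (hΔ0 : δ ≤ Δ ⟨0, by omega⟩)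
    (hΔN : Δ ⟨N - 1, by omega⟩ ≤ -δ) :
    ∑ n, Q n * Δ n ≤ -δ * (Q ⟨N - 1, by omega⟩ - Q ⟨0, by omega⟩) := by
  obtain ⟨k, hkN, hpos, hneg⟩ := hΔtilted
  have hk : k < N := by
    by_contra h
    have := hpos ⟨N - 1, by omega⟩ (by simp only; omega)
    linarith
  set a : Fin N := ⟨0, by omega⟩ with ha
  set b : Fin N := ⟨N - 1, by omega⟩ with hb
  set c : ℝ := Q ⟨k, hk⟩ with hc
  have hac : Q a ≤ c := hQmono _ _ (by simp [ha, Fin.le_def])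
  have hcb : c ≤ Q b := hQmono _ _ (by simp only [hb, Fin.le_def]; omega)
  have hab : a ≠ b := by
    simp only [ha, hb, ne_eq, Fin.mk.injEq]; omega
  have hterm : ∀ n ∈ Finset.univ, (Q n - c) * Δ n ≤
      (if n = a then (Q a - c) * δ else 0) + (if n = b then -((Q b - c) * δ) else 0) := by
    intro n _
    by_cases h1 : n = a
    · have h2 : n ≠ b := by rw [h1]; exact hab
      rw [if_pos h1, if_neg h2, h1]
      nlinarith
    · by_cases h2 : n = b
      · rw [if_neg h1, if_pos h2, h2]
        nlinarith
      · rw [if_neg h1, if_neg h2, add_zero]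
        rcases lt_or_ge (n : ℕ) k with h | h
        · have := hpos n h
          have h3 : Q n ≤ c := hQmono _ _ (by simp only [Fin.le_def]; omega)
          exact mul_nonpos_of_nonpos_of_nonneg (by linarith) this
        · have := hneg n h
          have h3 : c ≤ Q n := hQmono _ _ (by simp only [Fin.le_def]; omega)
          exact mul_nonpos_of_nonneg_of_nonpos (by linarith) this
  have hsum := Finset.sum_le_sum hterm
  have heq : ∑ n, (Q n - c) * Δ n = ∑ n, Q n * Δ n := by
    simp only [sub_mul, Finset.sum_sub_distrib, ← Finset.mul_sum, hΔsum, mul_zero, sub_zero]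
  rw [heq, Finset.sum_add_distrib, Finset.sum_ite_eq' , Finset.sum_ite_eq'] at hsum
  simp only [Finset.mem_univ, if_true] at hsum
  linarith
end

section
/- Let N ≥ 1, let μ : Fin N → ℝ with μ n > 0 for all n, set μ_Σ = ∑_n μ n, and let 0 < ε < μ_Σ with λ = μ_Σ - ε. Let Q : Fin N → ℝ be nonnegative and nondecreasing, and let Δ : Fin N → ℝ satisfy ∑_n Δ n = 0 and be tilted (there exists k ∈ ℕ with k ≤ N such that Δ n ≥ 0 for (n : ℕ) < k and Δ n ≤ 0 for (n : ℕ) ≥ k). Then ∑_n Q n * ((Δ n + μ n/μ_Σ) * λ - μ n) ≤ -ε * ((min_n μ n)/μ_Σ) * ‖Q‖, where ‖Q‖ is the Euclidean norm. -/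
/-- Lemma "tilted", Eq. (12): drift bound ⟨Q, A - S⟩ for a tilted distribution. -/
theorem tilted_drift_Q_bound
    (N : ℕ) (hN : 1 ≤ N) (μ Q Δ : Fin N → ℝ)
    (hμ : ∀ n, 0 < μ n)
    (ε : ℝ) (hε0 : 0 < ε) (hε : ε < ∑ n, μ n)
    (hQ0 : ∀ n, 0 ≤ Q n)
    (hQmono : ∀ i j : Fin N, i ≤ j → Q i ≤ Q j)
    (hΔsum : ∑ n, Δ n = 0)
    (hΔtilted : ∃ k : ℕ, k ≤ N ∧ (∀ n : Fin N, (n : ℕ) < k → 0 ≤ Δ n) ∧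
        (∀ n : Fin N, k ≤ (n : ℕ) → Δ n ≤ 0)) :
    ∑ n, Q n * ((Δ n + μ n / (∑ m, μ m)) * ((∑ m, μ m) - ε) - μ n)
      ≤ -ε *
        ((Finset.univ.inf' (Finset.univ_nonempty_iff.mpr (Fin.pos_iff_nonempty.mp (by omega))) μ) /
          (∑ m, μ m)) *
        Real.sqrt (∑ n, (Q n) ^ 2) := by
  obtain ⟨k, hk, h1, h2⟩ := hΔtilted
  have hQΔ : ∑ n, Q n * Δ n ≤ 0 := by
    obtain ⟨c, hc⟩ : ∃ c : ℝ, ∀ n, (Q n - c) * Δ n ≤ 0 := by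
      refine ⟨Q ⟨min k (N - 1), by omega⟩, fun n => ?_⟩
      rcases lt_or_ge (n : ℕ) k with h | h
      · refine mul_nonpos_of_nonpos_of_nonneg (sub_nonpos.mpr (hQmono _ _ ?_)) (h1 n h)
        rw [Fin.le_def]
        have := n.2
        simp only
        omega
      · refine mul_nonpos_of_nonneg_of_nonpos (sub_nonneg.mpr (hQmono _ _ ?_)) (h2 n h)
        rw [Fin.le_def]
        simp only
        omega
    have h := Finset.sum_nonpos (s := Finset.univ) (fun n _ => hc n)
    simp only [sub_mul, Finset.sum_sub_distrib, ← Finset.mul_sum, hΔsum] at h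
    linarith
  have hS : 0 < ∑ m, μ m := hε0.trans hε
  generalize hm : Finset.univ.inf' _ μ = m
  have hmle : ∀ n, m ≤ μ n := fun n => hm ▸ Finset.inf'_le _ (Finset.mem_univ n)
  have hm0 : 0 ≤ m := by
    rw [← hm]
    exact Finset.le_inf' _ _ (fun n _ => (hμ n).le)
  have hsq : Real.sqrt (∑ n, (Q n) ^ 2) ≤ ∑ n, Q n := by
    apply Real.sqrt_le_iff.mpr
    exact ⟨Finset.sum_nonneg fun n _ => hQ0 n,
      Finset.sum_sq_le_sq_sum_of_nonneg fun n _ => hQ0 n⟩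
  have hQμ : m * Real.sqrt (∑ n, (Q n) ^ 2) ≤ ∑ n, Q n * μ n := by
    refine (mul_le_mul_of_nonneg_left hsq hm0).trans ?_
    rw [Finset.mul_sum]
    refine Finset.sum_le_sum fun n _ => ?_
    rw [mul_comm]
    exact mul_le_mul_of_nonneg_left (hmle n) (hQ0 n)
  generalize (∑ m, μ m) = S at *
  have e : ∑ n, Q n * ((Δ n + μ n / S) * (S - ε) - μ n)
      = (S - ε) * (∑ n, Q n * Δ n) - ε / S * ∑ n, Q n * μ n := by
    rw [Finset.mul_sum, Finset.mul_sum, ← Finset.sum_sub_distrib]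
    refine Finset.sum_congr rfl fun n _ => ?_
    field_simp
    ring
  rw [e]
  have a := mul_nonpos_of_nonneg_of_nonpos (sub_nonneg.mpr hε.le) hQΔ
  have b := mul_le_mul_of_nonneg_left hQμ (div_pos hε0 hS).le
  have e2 : -ε * (m / S) * Real.sqrt (∑ n, (Q n) ^ 2)
      = -(ε / S * (m * Real.sqrt (∑ n, (Q n) ^ 2))) := by ring
  rw [e2]
  linarith
end

section
/- Let N ≥ 1, let μ : Fin N → ℝ with μ n > 0 for all n, set μ_Σ = ∑_n μ n, and let 0 < ε < μ_Σ with λ = μ_Σ - ε. Let Q : Fin N → ℝ be nonnegative and nondecreasing, let Q̄ = (∑_n Q n)/N, and let Δ : Fin N → ℝ satisfy ∑_n Δ n = 0 and be tilted (there exists k ∈ ℕ with k ≤ N such that Δ n ≥ 0 for (n : ℕ) < k and Δ n ≤ 0 for (n : ℕ) ≥ k). Then ∑_n (Q n - Q̄) * ((Δ n + μ n/μ_Σ) * λ - μ n) ≤ ε * √N * ‖Q - Q̄·𝟙‖, where ‖·‖ is the Euclidean norm and (Q - Q̄·𝟙) n = Q n - Q̄. -/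
/-- Lemma "tilted", Eq. (13): drift bound ⟨Q_⊥, A - S⟩ for a tilted distribution. -/
theorem tilted_drift_Qperp_bound
    (N : ℕ) (hN : 1 ≤ N) (μ Q Δ : Fin N → ℝ)
    (hμ : ∀ n, 0 < μ n)
    (ε : ℝ) (hε0 : 0 < ε) (hε : ε < ∑ n, μ n)
    (hQ0 : ∀ n, 0 ≤ Q n)
    (hQmono : ∀ i j : Fin N, i ≤ j → Q i ≤ Q j)
    (hΔsum : ∑ n, Δ n = 0)
    (hΔtilted : ∃ k : ℕ, k ≤ N ∧ (∀ n : Fin N, (n : ℕ) < k → 0 ≤ Δ n) ∧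
        (∀ n : Fin N, k ≤ (n : ℕ) → Δ n ≤ 0)) :
    ∑ n, (Q n - (∑ m, Q m) / (N : ℝ)) * ((Δ n + μ n / (∑ m, μ m)) * ((∑ m, μ m) - ε) - μ n)
      ≤ ε * Real.sqrt N * Real.sqrt (∑ n, (Q n - (∑ m, Q m) / (N : ℝ)) ^ 2) := by
  obtain ⟨k, hk, h1, h2⟩ := hΔtilted
  set S := ∑ m, μ m with hS
  set m := (∑ m, Q m) / (N : ℝ) with hm
  set R := Real.sqrt (∑ n, (Q n - m) ^ 2) with hR
  have hSpos : 0 < S := lt_trans hε0 hε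
  have hR0 : 0 ≤ R := Real.sqrt_nonneg _
  have hq : ∀ n, -(Q n - m) ≤ R := by
    intro n
    refine (neg_le_abs _).trans ?_
    apply Real.abs_le_sqrt
    exact Finset.single_le_sum (f := fun n => (Q n - m) ^ 2)
      (fun i _ => sq_nonneg _) (Finset.mem_univ n)
  obtain ⟨c, hc⟩ : ∃ c : ℝ, ∀ n, (Q n - c) * Δ n ≤ 0 := by
    refine ⟨Q ⟨min k (N - 1), by omega⟩, fun n => ?_⟩
    have hn := n.isLt
    by_cases h : (n : ℕ) < k
    · refine mul_nonpos_of_nonpos_of_nonneg (sub_nonpos.2 (hQmono _ _ ?_)) (h1 n h)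
      rw [Fin.le_def]
      simp only
      omega
    · refine mul_nonpos_of_nonneg_of_nonpos (sub_nonneg.2 (hQmono _ _ ?_)) (h2 n (by omega))
      rw [Fin.le_def]
      simp only
      omega
  have hterm : ∀ n, (Q n - m) * ((Δ n + μ n / S) * (S - ε) - μ n)
      ≤ (S - ε) * (c - m) * Δ n + ε * R / S * μ n := by
    intro n
    have e : (Q n - m) * ((Δ n + μ n / S) * (S - ε) - μ n)
        = (S - ε) * ((Q n - c) * Δ n) + (S - ε) * (c - m) * Δ n
          + (ε / S * μ n) * (-(Q n - m)) := by
      field_simp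
      ring
    have a := mul_nonpos_of_nonneg_of_nonpos (sub_nonneg.2 hε.le) (hc n)
    have b := mul_le_mul_of_nonneg_left (hq n)
      (mul_nonneg (div_nonneg hε0.le hSpos.le) (hμ n).le)
    have d : ε / S * μ n * R = ε * R / S * μ n := by ring
    linarith
  calc _ ≤ ∑ n, ((S - ε) * (c - m) * Δ n + ε * R / S * μ n) :=
        Finset.sum_le_sum fun n _ => hterm n
    _ = ε * R := by
        rw [Finset.sum_add_distrib, ← Finset.mul_sum, ← Finset.mul_sum, hΔsum, ← hS]
        field_simp
        ring
    _ ≤ ε * Real.sqrt N * R := by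
        have : 1 ≤ Real.sqrt N := Real.one_le_sqrt.2 (by exact_mod_cast hN)
        nlinarith [mul_nonneg (mul_nonneg hε0.le hR0) (sub_nonneg.2 this)]
end

section
/- Let N ≥ 2, let δ > 0, let μ : Fin N → ℝ with μ n > 0 for all n, set μ_Σ = ∑_n μ n, and let 0 < ε < μ_Σ with λ = μ_Σ - ε. Let Q : Fin N → ℝ be nonnegative and nondecreasing, let Q̄ = (∑_n Q n)/N, and let Δ : Fin N → ℝ satisfy ∑_n Δ n = 0, be tilted (there exists k ∈ ℕ with k ≤ N such that Δ n ≥ 0 for (n : ℕ) < k and Δ n ≤ 0 for (n : ℕ) ≥ k), and satisfy Δ 0 ≥ δ and Δ (N-1) ≤ -δ (i.e., Δ is δ-tilted). Then ∑_n (Q n - Q̄) * ((Δ n + μ n/μ_Σ) * λ - μ n) ≤ √N * ‖Q - Q̄·𝟙‖ * (ε - δ*λ/N), where ‖·‖ is the Euclidean norm. -/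
/-- Lemma "propertilted", Eq. (14): drift bound ⟨Q_⊥, A - S⟩ for a δ-tilted distribution. -/
theorem delta_tilted_drift_Qperp_bound
    (N : ℕ) (hN : 2 ≤ N) (δ : ℝ) (hδ : 0 < δ) (μ Q Δ : Fin N → ℝ)
    (hμ : ∀ n, 0 < μ n)
    (ε : ℝ) (hε0 : 0 < ε) (hε : ε < ∑ n, μ n)
    (hQ0 : ∀ n, 0 ≤ Q n)
    (hQmono : ∀ i j : Fin N, i ≤ j → Q i ≤ Q j)
    (hΔsum : ∑ n, Δ n = 0)
    (hΔtilted : ∃ k : ℕ, k ≤ N ∧ (∀ n : Fin N, (n : ℕ) < k → 0 ≤ Δ n) ∧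
        (∀ n : Fin N, k ≤ (n : ℕ) → Δ n ≤ 0))
    (hΔ0 : δ ≤ Δ ⟨0, by omega⟩)
    (hΔN : Δ ⟨N - 1, by omega⟩ ≤ -δ) :
    ∑ n, (Q n - (∑ m, Q m) / (N : ℝ)) * ((Δ n + μ n / (∑ m, μ m)) * ((∑ m, μ m) - ε) - μ n)
      ≤ Real.sqrt N * Real.sqrt (∑ n, (Q n - (∑ m, Q m) / (N : ℝ)) ^ 2) *
        (ε - δ * ((∑ m, μ m) - ε) / (N : ℝ)) := by
  obtain ⟨k, hk, hpos, hneg⟩ := hΔtilted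
  set a : Fin N := ⟨0, by omega⟩ with ha
  set b : Fin N := ⟨N - 1, by omega⟩ with hb
  set M := ∑ m, μ m with hM
  set q := (∑ m, Q m) / (N : ℝ) with hq
  have hNpos : (0 : ℝ) < N := by
    have : 0 < N := by omega
    exact_mod_cast this
  have hab : a ≠ b := by
    intro h
    have := congrArg Fin.val h
    simp [ha, hb] at this
    omega
  have hle_a : ∀ n, Q a ≤ Q n := fun n => hQmono _ _ (by simp [ha, Fin.le_def])
  have hle_b : ∀ n, Q n ≤ Q b := fun n => hQmono _ _ (by
    have := n.2
    simp only [hb, Fin.le_def]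
    omega)
  have hk0 : 0 < k := by
    by_contra h
    have := hneg a (by omega)
    linarith
  have hMpos : 0 < M := by linarith
  -- tilted part
  have htilt : ∑ n, (Q n - q) * Δ n ≤ -(δ * (Q b - Q a)) := by
    set c := Q ⟨k - 1, by omega⟩ with hc
    have h1 : ∑ n, (Q n - q) * Δ n = ∑ n, (Q n - c) * Δ n := by
      simp only [sub_mul, Finset.sum_sub_distrib, ← Finset.mul_sum, hΔsum, mul_zero]
    have hsgn : ∀ n, (Q n - c) * Δ n ≤ 0 := by
      intro n
      by_cases h : (n : ℕ) < k
      · have h2 : Q n ≤ c := hQmono _ _ (by simp only [Fin.le_def]; omega)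
        exact mul_nonpos_of_nonpos_of_nonneg (by linarith) (hpos n h)
      · have h2 : c ≤ Q n := hQmono _ _ (by simp only [Fin.le_def]; omega)
        exact mul_nonpos_of_nonneg_of_nonpos (by linarith) (hneg n (by omega))
    have hca := hle_a ⟨k - 1, by omega⟩
    have hcb := hle_b ⟨k - 1, by omega⟩
    rw [← hc] at hca hcb
    have h3 : ∀ n, (Q n - c) * Δ n ≤
        (if n = a then δ * (Q a - c) else 0) + (if n = b then -(δ * (Q b - c)) else 0) := by
      intro n
      by_cases hna : n = a
      · subst hna
        simp only [if_true, if_neg hab]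
        nlinarith
      · by_cases hnb : n = b
        · subst hnb
          simp only [if_true, if_neg hna]
          nlinarith
        · simp only [if_neg hna, if_neg hnb]
          linarith [hsgn n]
    have h4 := Finset.sum_le_sum (fun n (_ : n ∈ Finset.univ) => h3 n)
    rw [Finset.sum_add_distrib, Finset.sum_ite_eq', Finset.sum_ite_eq'] at h4
    simp only [Finset.mem_univ, if_true] at h4
    rw [h1]
    linarith
  -- mean lies between the extremes
  have hsumQ : ∑ m, Q m = N * q := by rw [hq]; field_simp
  have hqa : Q a ≤ q := by
    rw [hq, le_div_iff₀ hNpos]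
    have := Finset.sum_le_sum (fun n (_ : n ∈ Finset.univ) => hle_a n)
    simp at this
    linarith
  have hqb : q ≤ Q b := by
    rw [hq, div_le_iff₀ hNpos]
    have := Finset.sum_le_sum (fun n (_ : n ∈ Finset.univ) => hle_b n)
    simp at this
    linarith
  set X := Real.sqrt (∑ n, (Q n - q) ^ 2) with hX
  have hX0 : 0 ≤ X := Real.sqrt_nonneg _
  set s := Real.sqrt N with hs
  have hss : s * s = N := Real.mul_self_sqrt hNpos.le
  have hs1 : 1 ≤ s := by
    rw [hs, Real.one_le_sqrt]
    have : 1 ≤ N := by omega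
    exact_mod_cast this
  have hXD : X ≤ s * (Q b - Q a) := by
    rw [hX]
    apply Real.sqrt_le_iff.mpr
    refine ⟨mul_nonneg (by linarith) (by linarith), ?_⟩
    have h5 : ∀ n, (Q n - q) ^ 2 ≤ (Q b - Q a) ^ 2 := fun n => by
      apply sq_le_sq'
      · linarith [hle_a n]
      · linarith [hle_b n]
    have h6 := Finset.sum_le_sum (fun n (_ : n ∈ Finset.univ) => h5 n)
    simp only [Finset.sum_const, Finset.card_univ, Fintype.card_fin, nsmul_eq_mul] at h6
    rw [mul_pow, pow_two s, hss]
    exact h6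
  have hxX : ∀ n, -(Q n - q) ≤ X := by
    intro n
    refine (neg_le_abs _).trans ?_
    rw [hX]
    apply Real.abs_le_sqrt
    exact Finset.single_le_sum (f := fun n => (Q n - q) ^ 2) (fun i _ => sq_nonneg _)
      (Finset.mem_univ n)
  have hmu : -∑ n, (Q n - q) * μ n ≤ X * M := by
    rw [hM, Finset.mul_sum, ← Finset.sum_neg_distrib]
    apply Finset.sum_le_sum
    intro n _
    have := mul_le_mul_of_nonneg_right (hxX n) (hμ n).le
    linarith
  have hdecomp : ∑ n, (Q n - q) * ((Δ n + μ n / M) * (M - ε) - μ n)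
      = (M - ε) * ∑ n, (Q n - q) * Δ n + ε / M * (-∑ n, (Q n - q) * μ n) := by
    rw [← Finset.sum_neg_distrib, Finset.mul_sum, Finset.mul_sum, ← Finset.sum_add_distrib]
    apply Finset.sum_congr rfl
    intro n _
    field_simp
    ring
  rw [hdecomp]
  have hA : ε / M * (-∑ n, (Q n - q) * μ n) ≤ s * X * ε := by
    calc ε / M * (-∑ n, (Q n - q) * μ n) ≤ ε / M * (X * M) :=
          mul_le_mul_of_nonneg_left hmu (by positivity)
      _ = 1 * (X * ε) := by field_simp
      _ ≤ s * (X * ε) := mul_le_mul_of_nonneg_right hs1 (by positivity)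
      _ = s * X * ε := by ring
  have hB : (M - ε) * ∑ n, (Q n - q) * Δ n ≤ -(s * X * (δ * (M - ε) / N)) := by
    have h7 : s * X / N ≤ Q b - Q a := by
      rw [div_le_iff₀ hNpos, ← hss]
      nlinarith
    have h8 : δ * (s * X / N) ≤ δ * (Q b - Q a) := mul_le_mul_of_nonneg_left h7 hδ.le
    calc (M - ε) * ∑ n, (Q n - q) * Δ n ≤ (M - ε) * (-(δ * (s * X / N))) :=
          mul_le_mul_of_nonneg_left (by linarith) (by linarith)
      _ = _ := by ring
  calc _ ≤ -(s * X * (δ * (M - ε) / N)) + s * X * ε := add_le_add hB hA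
    _ = _ := by ring
end

section
/- Let N ≥ 1 and let q, u : Fin N → ℝ be nonnegative (q n ≥ 0 and u n ≥ 0 for all n) and a, s : Fin N → ℝ arbitrary. Define Q⁺ = q + a - s + u (componentwise). For x : Fin N → ℝ, let x_∥ = ⟨c, x⟩·c where c = (1/√N)·𝟙 is the unit vector in the direction 𝟙 = (1,...,1). Then ‖Q⁺_∥‖² - ‖q_∥‖² ≥ 2 * ⟨q_∥, a - s⟩. -/
/-- Lemma "drift_of_Qparallel": ‖Q⁺_∥‖² - ‖q_∥‖² ≥ 2⟨q_∥, a - s⟩,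
where x_∥ = ⟨c, x⟩·c and c = (1/√N)·𝟙. -/
theorem drift_of_Q_parallel
    (N : ℕ) (hN : 1 ≤ N) (q a s u Qp qpar Qppar : Fin N → ℝ)
    (hq : ∀ n, 0 ≤ q n) (hu : ∀ n, 0 ≤ u n)
    (hQp : ∀ n, Qp n = q n + a n - s n + u n)
    (hqpar : ∀ n, qpar n = ((1 / Real.sqrt N) * ∑ m, q m) * (1 / Real.sqrt N))
    (hQppar : ∀ n, Qppar n = ((1 / Real.sqrt N) * ∑ m, Qp m) * (1 / Real.sqrt N)) :
    2 * ∑ n, qpar n * (a n - s n)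
      ≤ (∑ n, (Qppar n) ^ 2) - ∑ n, (qpar n) ^ 2 := by
  have hNpos : (0 : ℝ) < N := by exact_mod_cast hN
  have hs : (1 / Real.sqrt N) * (1 / Real.sqrt N) = 1 / (N : ℝ) := by
    rw [div_mul_div_comm, Real.mul_self_sqrt hNpos.le, one_mul]
  have h1 : ∀ n, qpar n = (∑ m, q m) / N := by
    intro n
    rw [hqpar n, mul_right_comm, hs]
    ring
  have h2 : ∀ n, Qppar n = (∑ m, Qp m) / N := by
    intro n
    rw [hQppar n, mul_right_comm, hs]
    ring
  have h3 : ∑ m, Qp m = ∑ m, q m + ∑ m, (a m - s m) + ∑ m, u m := by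
    rw [← Finset.sum_add_distrib, ← Finset.sum_add_distrib]
    refine Finset.sum_congr rfl fun n _ => ?_
    rw [hQp n]
    ring
  have hA : 0 ≤ ∑ m, q m := Finset.sum_nonneg fun n _ => hq n
  have hU : 0 ≤ ∑ m, u m := Finset.sum_nonneg fun n _ => hu n
  simp only [h1, h2, ← Finset.mul_sum, Finset.sum_const, Finset.card_univ, Fintype.card_fin,
    nsmul_eq_mul, h3]
  generalize ∑ m, q m = A at *
  generalize ∑ m, (a m - s m) = D at *
  generalize ∑ m, u m = U at *
  have key : (N : ℝ) * ((A + D + U) / N) ^ 2 - N * (A / N) ^ 2 - 2 * (A / N * D)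
      = (2 * (A * U) + (D + U) ^ 2) / N := by
    field_simp
    ring
  have : 0 ≤ (2 * (A * U) + (D + U) ^ 2) / N := by positivity
  linarith
end

section
/- Let N ≥ 2 and 2 ≤ d ≤ N. Define P : Fin N → ℝ (indices 0-based) by P n = (choose (N-1-n) (d-1)) / (choose N d) if n ≤ N-d, and P n = 0 if n > N-d, and set Δ n = P n - 1/N. Then: (i) P is nonincreasing (P m ≥ P n whenever m ≤ n); (ii) ∑_n Δ n = 0; (iii) Δ 0 = (d-1)/N ≥ 1/N; (iv) Δ (N-1) = -1/N; and (v) Δ is tilted, i.e., there exists k ∈ ℕ with k ≤ N such that Δ n ≥ 0 for (n : ℕ) < k and Δ n ≤ 0 for (n : ℕ) ≥ k. Consequently Δ is δ-tilted with δ = 1/N. -/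
theorem sum_choose_aux (e N : ℕ) :
    ∑ j ∈ Finset.range N, j.choose e = N.choose (e + 1) := by
  induction N with
  | zero => simp
  | succ N ih => rw [Finset.sum_range_succ, ih, Nat.choose_succ_succ, add_comm]

/-- Proposition 2: for homogeneous servers the power-of-d dispatching distribution
is δ-tilted with δ = 1/N. -/
theorem power_of_d_delta_tilted
    (N d : ℕ) (hN : 2 ≤ N) (hd1 : 2 ≤ d) (hdN : d ≤ N)
    (P Δ : Fin N → ℝ)
    (hP : ∀ n : Fin N, P n =
      if (n : ℕ) ≤ N - d then
        ((N - 1 - (n : ℕ)).choose (d - 1) : ℝ) / (N.choose d : ℝ)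
      else 0)
    (hΔ : ∀ n, Δ n = P n - 1 / (N : ℝ)) :
    (∀ m n : Fin N, m ≤ n → P n ≤ P m) ∧
    (∑ n, Δ n = 0) ∧
    (Δ ⟨0, by omega⟩ = ((d : ℝ) - 1) / (N : ℝ)) ∧
    (1 / (N : ℝ) ≤ Δ ⟨0, by omega⟩) ∧
    (Δ ⟨N - 1, by omega⟩ = -(1 / (N : ℝ))) ∧
    (∃ k : ℕ, k ≤ N ∧ (∀ n : Fin N, (n : ℕ) < k → 0 ≤ Δ n) ∧
        (∀ n : Fin N, k ≤ (n : ℕ) → Δ n ≤ 0)) := by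
  obtain ⟨e, rfl⟩ : ∃ e, d = e + 1 := ⟨d - 1, by omega⟩
  have hC : (0 : ℝ) < (N.choose (e + 1) : ℝ) := by exact_mod_cast Nat.choose_pos hdN
  have hN0 : (0 : ℝ) < (N : ℝ) := by exact_mod_cast (by omega : 0 < N)
  have hP2 : ∀ n : Fin N, P n = ((N - 1 - (n : ℕ)).choose e : ℝ) / (N.choose (e + 1) : ℝ) := by
    intro n
    rw [hP n]
    split_ifs with h
    · simp
    · rw [Nat.choose_eq_zero_of_lt (by omega)]
      simp
  have hmono : ∀ m n : Fin N, m ≤ n → P n ≤ P m := by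
    intro m n hmn
    rw [hP2, hP2]
    have h1 : (m : ℕ) ≤ n := hmn
    have h2 : (N - 1 - (n : ℕ)).choose e ≤ (N - 1 - (m : ℕ)).choose e :=
      Nat.choose_le_choose e (by omega)
    have h3 : ((N - 1 - (n : ℕ)).choose e : ℝ) ≤ ((N - 1 - (m : ℕ)).choose e : ℝ) := by
      exact_mod_cast h2
    gcongr
  have h0 : Δ ⟨0, by omega⟩ = (((e + 1 : ℕ) : ℝ) - 1) / (N : ℝ) := by
    rw [hΔ, hP2]
    obtain ⟨M, rfl⟩ : ∃ M, N = M + 1 := ⟨N - 1, by omega⟩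
    have h := Nat.add_one_mul_choose_eq M e
    have h' : ((M + 1 : ℕ) : ℝ) * (M.choose e : ℝ) =
        ((M + 1).choose (e + 1) : ℝ) * ((e + 1 : ℕ) : ℝ) := by exact_mod_cast h
    have h4 : (M.choose e : ℝ) / ((M + 1).choose (e + 1) : ℝ) =
        ((e + 1 : ℕ) : ℝ) / ((M + 1 : ℕ) : ℝ) := by
      rw [div_eq_div_iff hC.ne' hN0.ne']
      linarith
    simp only [Nat.add_sub_cancel, Nat.sub_zero]
    rw [h4, sub_div]
  refine ⟨hmono, ?_, h0, ?_, ?_, ?_⟩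
  · have hs : ∑ n : Fin N, ((N - 1 - (n : ℕ)).choose e : ℝ) = (N.choose (e + 1) : ℝ) := by
      rw [Fin.sum_univ_eq_sum_range (fun i => ((N - 1 - i).choose e : ℝ)) N,
        Finset.sum_range_reflect (fun i => (i.choose e : ℝ)) N]
      exact_mod_cast sum_choose_aux e N
    simp only [hΔ, hP2]
    rw [Finset.sum_sub_distrib, ← Finset.sum_div, hs, div_self hC.ne']
    simp [hN0.ne']
  · rw [h0]
    have : (2 : ℝ) ≤ ((e + 1 : ℕ) : ℝ) := by exact_mod_cast hd1
    gcongr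
    linarith
  · rw [hΔ, hP2]
    simp only [Nat.sub_self]
    rw [Nat.choose_eq_zero_of_lt (by omega)]
    simp
  · classical
    have hex : ∃ k : ℕ, ∀ n : Fin N, k ≤ (n : ℕ) → Δ n ≤ 0 :=
      ⟨N, fun n hn => absurd n.isLt (by omega)⟩
    refine ⟨Nat.find hex, Nat.find_min' hex (fun n hn => absurd n.isLt (by omega)), ?_,
      Nat.find_spec hex⟩
    intro n hn
    have h := Nat.find_min hex hn
    push Not at h
    obtain ⟨m, hm, hpos⟩ := h
    have := hmono n m hm
    rw [hΔ] at hpos ⊢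
    linarith
end

section
/- Let N ≥ 3 and 1 ≤ d ≤ N, let μ : Fin N → ℝ with μ n > 0 for all n, and set μ_Σ = ∑_n μ n, μ_max = max_n μ n, μ_min = min_n μ n. Define P̂ : Fin N → ℝ (0-indexed) by P̂ 0 = d/N + (1 - d/N)*μ 0/μ_Σ, P̂ 1 = (1 - d/N)*(∑_{n=1}^{N-1} μ n)/μ_Σ, and P̂ n = 0 for n ≥ 2, and set Δ n = P̂ n - μ n/μ_Σ. Then ∑_n P̂ n = 1, Δ 0 = (d/N)*(1 - μ 0/μ_Σ) ≥ (d/N)*(1 - μ_max/μ_Σ), Δ (N-1) = -μ (N-1)/μ_Σ ≤ -μ_min/μ_Σ, and Δ is tilted (there exists k ∈ ℕ with k ≤ N such that Δ n ≥ 0 for (n : ℕ) < k and Δ n ≤ 0 for (n : ℕ) ≥ k). Consequently, if moreover N ≥ 2 so that μ_max < μ_Σ, Δ is δ-tilted with δ = min{(d/N)*(1 - μ_max/μ_Σ), μ_min/μ_Σ} > 0. -/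
/-- Case (b) in the proof of Proposition 3, assertion 2: after a threshold
update, the JBTG-d dispatching distribution (up to inner-product equivalence)
is δ-tilted with δ = min{(d/N)(1 - μ_max/μ_Σ), μ_min/μ_Σ}. -/
theorem jbtg_worst_case_delta_tilted
    (N d : ℕ) (hN : 3 ≤ N) (hd1 : 1 ≤ d) (hdN : d ≤ N)
    (μ : Fin N → ℝ) (hμ : ∀ n, 0 < μ n)
    (P Δ : Fin N → ℝ)
    (hP : ∀ n : Fin N, P n =
      if (n : ℕ) = 0 then
        (d : ℝ) / (N : ℝ) + (1 - (d : ℝ) / (N : ℝ)) * μ ⟨0, by omega⟩ / (∑ m, μ m)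
      else if (n : ℕ) = 1 then
        (1 - (d : ℝ) / (N : ℝ)) *
          (∑ m ∈ Finset.univ.filter (fun m : Fin N => 1 ≤ (m : ℕ)), μ m) / (∑ m, μ m)
      else 0)
    (hΔ : ∀ n, Δ n = P n - μ n / (∑ m, μ m)) :
    (∑ n, P n = 1) ∧
    (Δ ⟨0, by omega⟩ = ((d : ℝ) / (N : ℝ)) * (1 - μ ⟨0, by omega⟩ / (∑ m, μ m))) ∧
    (((d : ℝ) / (N : ℝ)) *
        (1 - (Finset.univ.sup' (Finset.univ_nonempty_iff.mpr (Fin.pos_iff_nonempty.mp (by omega))) μ)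
              / (∑ m, μ m))
      ≤ Δ ⟨0, by omega⟩) ∧
    (Δ ⟨N - 1, by omega⟩ = -(μ ⟨N - 1, by omega⟩ / (∑ m, μ m))) ∧
    (Δ ⟨N - 1, by omega⟩
      ≤ -((Finset.univ.inf' (Finset.univ_nonempty_iff.mpr (Fin.pos_iff_nonempty.mp (by omega))) μ)
            / (∑ m, μ m))) ∧
    (∃ k : ℕ, k ≤ N ∧ (∀ n : Fin N, (n : ℕ) < k → 0 ≤ Δ n) ∧
        (∀ n : Fin N, k ≤ (n : ℕ) → Δ n ≤ 0)) ∧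
    (0 < min
        (((d : ℝ) / (N : ℝ)) *
          (1 - (Finset.univ.sup' (Finset.univ_nonempty_iff.mpr (Fin.pos_iff_nonempty.mp (by omega))) μ)
                / (∑ m, μ m)))
        ((Finset.univ.inf' (Finset.univ_nonempty_iff.mpr (Fin.pos_iff_nonempty.mp (by omega))) μ)
            / (∑ m, μ m))) ∧
    (min
        (((d : ℝ) / (N : ℝ)) *
          (1 - (Finset.univ.sup' (Finset.univ_nonempty_iff.mpr (Fin.pos_iff_nonempty.mp (by omega))) μ)
                / (∑ m, μ m)))
        ((Finset.univ.inf' (Finset.univ_nonempty_iff.mpr (Fin.pos_iff_nonempty.mp (by omega))) μ)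
            / (∑ m, μ m))
      ≤ Δ ⟨0, by omega⟩) ∧
    (Δ ⟨N - 1, by omega⟩
      ≤ -(min
          (((d : ℝ) / (N : ℝ)) *
            (1 - (Finset.univ.sup' (Finset.univ_nonempty_iff.mpr (Fin.pos_iff_nonempty.mp (by omega))) μ)
                  / (∑ m, μ m)))
          ((Finset.univ.inf' (Finset.univ_nonempty_iff.mpr (Fin.pos_iff_nonempty.mp (by omega))) μ)
              / (∑ m, μ m)))) := by
  obtain ⟨M, rfl⟩ : ∃ M, N = M + 3 := ⟨N - 3, by omega⟩
  set S : ℝ := ∑ m, μ m with hS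
  have hne : (Finset.univ : Finset (Fin (M + 3))).Nonempty := Finset.univ_nonempty
  have hSpos : 0 < S := Finset.sum_pos (fun i _ => hμ i) hne
  have hT : (∑ m ∈ Finset.univ.filter (fun m : Fin (M + 3) => 1 ≤ (m : ℕ)), μ m)
      = S - μ ⟨0, by omega⟩ := by
    rw [hS, Finset.sum_filter, Fin.sum_univ_succ, Fin.sum_univ_succ (f := μ)]
    simp
  rw [hT] at hP
  set r : ℝ := (d : ℝ) / ((M + 3 : ℕ) : ℝ) with hr
  have hrpos : 0 < r := by
    have : (0 : ℝ) < d := by exact_mod_cast hd1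
    positivity
  set mx : ℝ := Finset.univ.sup' hne μ with hmx
  set mn : ℝ := Finset.univ.inf' hne μ with hmn
  have h0mx : μ ⟨0, by omega⟩ ≤ mx := Finset.le_sup' μ (Finset.mem_univ _)
  have hlmn : mn ≤ μ ⟨M + 3 - 1, by omega⟩ := Finset.inf'_le μ (Finset.mem_univ _)
  have hmnpos : 0 < mn := (Finset.lt_inf'_iff hne).2 (fun i _ => hμ i)
  have hmxS : mx < S := by
    refine (Finset.sup'_lt_iff hne).2 (fun i _ => ?_)
    obtain ⟨j, hj⟩ := exists_ne i
    exact Finset.single_lt_sum hj (Finset.mem_univ _) (Finset.mem_univ _) (hμ j)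
      (fun k _ _ => (hμ k).le)
  have hsum : ∑ n, P n = 1 := by
    rw [Fin.sum_univ_succ, Fin.sum_univ_succ]
    simp only [hP]
    simp
    field_simp
    ring
  have hD0 : Δ ⟨0, by omega⟩ = r * (1 - μ ⟨0, by omega⟩ / S) := by
    rw [hΔ, hP]
    simp
    ring
  have hDge : ∀ n : Fin (M + 3), 2 ≤ (n : ℕ) → Δ n = -(μ n / S) := by
    intro n hn
    rw [hΔ, hP, if_neg (by omega), if_neg (by omega)]
    ring
  have hDl := hDge ⟨M + 3 - 1, by omega⟩ (by simp)
  have h3 : r * (1 - mx / S) ≤ Δ ⟨0, by omega⟩ := by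
    rw [hD0]
    gcongr
  have h5 : Δ ⟨M + 3 - 1, by omega⟩ ≤ -(mn / S) := by
    rw [hDl]
    gcongr
  have hmx1 : 0 < 1 - mx / S := by
    have := (div_lt_one hSpos).2 hmxS
    linarith
  have hpos1 : 0 < r * (1 - mx / S) := mul_pos hrpos hmx1
  have hpos2 : 0 < mn / S := div_pos hmnpos hSpos
  have hDneg : ∀ n : Fin (M + 3), 2 ≤ (n : ℕ) → Δ n ≤ 0 := by
    intro n hn
    rw [hDge n hn]
    have := div_pos (hμ n) hSpos
    linarith
  have hzero : ∀ n : Fin (M + 3), (n : ℕ) = 0 → 0 ≤ Δ n := by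
    intro n hn
    have : n = ⟨0, by omega⟩ := Fin.ext hn
    rw [this]
    linarith
  refine ⟨hsum, hD0, h3, hDl, h5, ?_, lt_min hpos1 hpos2, (min_le_left _ _).trans h3,
    h5.trans (neg_le_neg (min_le_right _ _))⟩
  rcases le_total 0 (Δ ⟨1, by omega⟩) with h | h
  · refine ⟨2, by omega, fun n hn => ?_, hDneg⟩
    by_cases h0 : (n : ℕ) = 0
    · exact hzero n h0
    · have : n = ⟨1, by omega⟩ := Fin.ext (by simp; omega)
      rw [this]
      exact h
  · refine ⟨1, by omega, fun n hn => hzero n (by omega), fun n hn => ?_⟩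
    by_cases h1 : (n : ℕ) = 1
    · have : n = ⟨1, by omega⟩ := Fin.ext h1
      rw [this]
      exact h
    · exact hDneg n (by omega)
end
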